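/- arXiv:2311.11987 — 2 statements merged into one kernel-verified Lean document; each statement's English description precedes it below -/
import Mathlib

section
/- Let L be a nilpotent symplectic alternating algebra of dimension 2n ≥ 2. Then there exists an ascending chain of isotropic ideals 0 = I_0 < I_1 < ⋯ < I_{n−1} < I_n with dim I_r = r for r = 0, …, n, such that moreover, if 2n ≥ 6, the subspace I_{n−1}^⊥ is abelian and the ascending chain 0 < I_2 < I_3 < ⋯ < I_{n−1} < I_{n−1}^⊥ < I_{n−2}^⊥ < ⋯ < I_2^⊥ < L is central in L (each term multiplied by L is contained in the previous term); in particular, L is nilpotent of class at most 2n − 3. -/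
/-- A symplectic alternating algebra structure on an `F`-vector space `L`:
a nondegenerate alternating bilinear form together with an alternating
bilinear product satisfying `(x·y, z) = (y·z, x)`. -/
structure SAAStruct (F : Type*) [Field F] (L : Type*) [AddCommGroup L] [Module F L] where
  form : L →ₗ[F] L →ₗ[F] F
  mul : L →ₗ[F] L →ₗ[F] L
  form_alt : ∀ x : L, form x x = 0
  form_nondegen : ∀ x : L, (∀ y : L, form x y = 0) → x = 0
  mul_alt : ∀ x : L, mul x x = 0
  cyclic : ∀ x y z : L, form (mul x y) z = form (mul y z) x

namespace SAAStruct

variable {F : Type*} [Field F] {L : Type*} [AddCommGroup L] [Module F L]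

/-- `I` is an ideal of the symplectic alternating algebra `A`. -/
def IsIdealSub (A : SAAStruct F L) (I : Submodule F L) : Prop :=
  ∀ x ∈ I, ∀ y : L, A.mul x y ∈ I

/-- An ascending chain of ideals `⊥ = I 0 ≤ I 1 ≤ ⋯ ≤ I k = ⊤`
with `I (s+1) · L ⊆ I s`. -/
def CentralChain (A : SAAStruct F L) (I : ℕ → Submodule F L) (k : ℕ) : Prop :=
  I 0 = ⊥ ∧ I k = ⊤ ∧ (∀ s, s < k → I s ≤ I (s + 1)) ∧
  (∀ s, s ≤ k → A.IsIdealSub (I s)) ∧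
  (∀ s, s < k → ∀ x ∈ I (s + 1), ∀ y : L, A.mul x y ∈ I s)

/-- `A` is nilpotent if it admits a central chain of ideals. -/
def IsNilpotent (A : SAAStruct F L) : Prop :=
  ∃ (k : ℕ) (I : ℕ → Submodule F L), A.CentralChain I k

/-- The nilpotency class of `A`: the least length of a central chain of ideals. -/
noncomputable def nilClass (A : SAAStruct F L) : ℕ :=
  sInf {k | ∃ I : ℕ → Submodule F L, A.CentralChain I k}

/-- The center `Z(L) = {x : x·L = 0}`. -/
def center (A : SAAStruct F L) : Submodule F L := LinearMap.ker A.mul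

/-- The lower central series, indexed so that `lcs A i` is `L^(i+1)`:
`lcs A 0 = L¹ = L` and `lcs A (i+1) = L^(i+2) = span {u·v : u ∈ L^(i+1), v ∈ L}`. -/
def lcs (A : SAAStruct F L) : ℕ → Submodule F L
  | 0 => ⊤
  | (i + 1) => Submodule.span F {z | ∃ u ∈ A.lcs i, ∃ v : L, z = A.mul u v}

/-- The upper central series: `ucs A 0 = 0`, `ucs A (i+1) = {x : x·L ⊆ ucs A i}`. -/
def ucs (A : SAAStruct F L) : ℕ → Submodule F L
  | 0 => ⊥
  | (i + 1) =>
    { carrier := {x | ∀ y : L, A.mul x y ∈ A.ucs i}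
      add_mem' := by
        intro a b ha hb y
        simpa [map_add, LinearMap.add_apply] using
          Submodule.add_mem _ (ha y) (hb y)
      zero_mem' := by
        intro y
        simp
      smul_mem' := by
        intro c a ha y
        simpa [map_smul, LinearMap.smul_apply] using
          Submodule.smul_mem _ c (ha y) }

/-- The perp `U^⊥ = {x : (x,u) = 0 for all u ∈ U}` of a subspace with
respect to the alternating form of `A`. -/
def perp (A : SAAStruct F L) (U : Submodule F L) : Submodule F L :=
  { carrier := {x | ∀ u ∈ U, A.form x u = 0}
    add_mem' := by
      intro a b ha hb u hu
      simp [map_add, LinearMap.add_apply, ha u hu, hb u hu]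
    zero_mem' := by
      intro u hu
      simp
    smul_mem' := by
      intro c a ha u hu
      simp [map_smul, LinearMap.smul_apply, ha u hu] }

/-- A subspace is isotropic if the form vanishes identically on it. -/
def Isotropic (A : SAAStruct F L) (U : Submodule F L) : Prop :=
  ∀ u ∈ U, ∀ v ∈ U, A.form u v = 0

/-- A subspace is abelian if the product vanishes identically on it. -/
def AbelianSub (A : SAAStruct F L) (U : Submodule F L) : Prop :=
  ∀ u ∈ U, ∀ v ∈ U, A.mul u v = 0

end SAAStruct

/-- The function `Ω` with `Ω 0 = 0` and `Ω (m+1) = 2 + C(Ω m, 2)`. -/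
def OmegaFn : ℕ → ℕ
  | 0 => 0
  | (m + 1) => 2 + Nat.choose (OmegaFn m) 2

/-- The entries of the Gram matrix of a standard (symplectic) basis
`x₁, y₁, x₂, y₂, …` enumerated as `b 0 = x₁, b 1 = y₁, b 2 = x₂, …`. -/
def stdJ (F : Type*) [Field F] {N : ℕ} (i j : Fin N) : F :=
  if (i : ℕ) % 2 = 0 ∧ (j : ℕ) = (i : ℕ) + 1 then 1
  else if (j : ℕ) % 2 = 0 ∧ (i : ℕ) = (j : ℕ) + 1 then -1
  else 0

namespace SAAStruct

variable {F : Type*} [Field F] {L : Type*} [AddCommGroup L] [Module F L]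

theorem form_neg (A : SAAStruct F L) (x y : L) : -A.form x y = A.form y x :=
  LinearMap.IsAlt.neg A.form_alt x y

theorem form_symm_zero (A : SAAStruct F L) {x y : L} (h : A.form x y = 0) : A.form y x = 0 := by
  rw [← A.form_neg, h, neg_zero]

theorem mul_neg (A : SAAStruct F L) (x y : L) : -A.mul x y = A.mul y x :=
  LinearMap.IsAlt.neg A.mul_alt x y

theorem form_mul_right (A : SAAStruct F L) (x y z : L) :
    A.form (A.mul x y) z = -A.form x (A.mul y z) := by
  rw [A.cyclic, A.form_neg]

theorem form_mul_self_right (A : SAAStruct F L) (x y : L) : A.form (A.mul x y) y = 0 := by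
  rw [A.cyclic, A.mul_alt, map_zero, LinearMap.zero_apply]

theorem perp_eq_orthogonal (A : SAAStruct F L) (U : Submodule F L) :
    A.perp U = LinearMap.BilinForm.orthogonal A.form U := by
  ext x
  exact forall₂_congr fun u _ => ⟨A.form_symm_zero, A.form_symm_zero⟩

theorem form_nondegenerate (A : SAAStruct F L) : A.form.Nondegenerate :=
  (LinearMap.IsRefl.nondegenerate_iff_separatingLeft
    (LinearMap.IsAlt.isRefl A.form_alt)).2 A.form_nondegen

theorem finrank_perp [FiniteDimensional F L] (A : SAAStruct F L) (U : Submodule F L) :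
    Module.finrank F (A.perp U) = Module.finrank F L - Module.finrank F U := by
  rw [perp_eq_orthogonal, LinearMap.BilinForm.finrank_orthogonal A.form_nondegenerate]

theorem perp_perp [FiniteDimensional F L] (A : SAAStruct F L) (U : Submodule F L) :
    A.perp (A.perp U) = U := by
  rw [perp_eq_orthogonal, perp_eq_orthogonal,
    LinearMap.BilinForm.orthogonal_orthogonal A.form_nondegenerate
      (LinearMap.IsAlt.isRefl A.form_alt)]

theorem perp_anti (A : SAAStruct F L) {U V : Submodule F L} (h : U ≤ V) : A.perp V ≤ A.perp U :=
  fun _ hx u hu => hx u (h hu)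

theorem Isotropic.le_perp {A : SAAStruct F L} {U : Submodule F L} (h : A.Isotropic U) :
    U ≤ A.perp U :=
  fun x hx u hu => h x hx u hu

/-- If `V · L ⊆ U` then `U^⊥ · L ⊆ V^⊥`. -/
theorem mul_mem_perp (A : SAAStruct F L) {U V : Submodule F L}
    (h : ∀ x ∈ V, ∀ y : L, A.mul x y ∈ U) {x : L} (hx : x ∈ A.perp U) (y : L) :
    A.mul x y ∈ A.perp V := by
  intro v hv
  rw [A.form_mul_right, ← A.mul_neg v y, map_neg, neg_neg]
  exact hx _ (h v hv y)

theorem IsIdealSub.perp {A : SAAStruct F L} {U : Submodule F L} (h : A.IsIdealSub U) :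
    A.IsIdealSub (A.perp U) :=
  fun _ hx y => A.mul_mem_perp h hx y

/-- An element multiplying `L` into a line annihilates `L`. -/
theorem mul_eq_zero_of_mem_finrank_one (A : SAAStruct F L) {I : Submodule F L}
    (hI : Module.finrank F I = 1) {x : L} (hx : ∀ y, A.mul x y ∈ I) (y : L) :
    A.mul x y = 0 := by
  obtain ⟨⟨a, haI⟩, ha0, ha⟩ := finrank_eq_one_iff'.1 hI
  have key : ∀ z, ∃ c : F, A.mul x z = c • a := fun z => by
    obtain ⟨c, hc⟩ := ha ⟨_, hx z⟩
    exact ⟨c, (congrArg Subtype.val hc).symm⟩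
  have ha0' : a ≠ 0 := fun h => ha0 (Subtype.ext h)
  by_contra hy
  obtain ⟨c, hc⟩ := key y
  have hc0 : c ≠ 0 := by
    rintro rfl
    exact hy (by rw [hc, zero_smul])
  have hay : A.form a y = 0 := by
    have := A.form_mul_self_right x y
    rw [hc] at this
    simpa [hc0] using this
  obtain ⟨w, hw⟩ : ∃ w, A.form a w ≠ 0 := by
    by_contra! h
    exact ha0' (A.form_nondegen a h)
  obtain ⟨d, hd⟩ := key w
  have hd0 : d = 0 := by
    have := A.form_mul_self_right x w
    rw [hd] at this
    simpa [hw] using this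
  have := A.form_mul_self_right x (y + w)
  rw [(A.mul x).map_add, hc, hd, hd0] at this
  simp [hay, hc0, hw] at this

/-- An ideal not containing a second ideal can be enlarged by an element of the latter
that is central modulo the former. -/
theorem IsNilpotent.exists_central_mod {A : SAAStruct F L} (hA : A.IsNilpotent)
    {I P : Submodule F L} (hP : A.IsIdealSub P) (hPI : ¬ P ≤ I) :
    ∃ x ∈ P, x ∉ I ∧ ∀ y, A.mul x y ∈ I := by
  obtain ⟨k, K, hK0, hKk, -, -, hK⟩ := hA
  by_contra! H
  have : ∀ s ≤ k, P ⊓ K s ≤ I := by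
    intro s
    induction s with
    | zero => simp [hK0]
    | succ s ih =>
      rintro hs x ⟨hxP, hxK⟩
      by_contra hxI
      obtain ⟨y, hy⟩ := H x hxP hxI
      exact hy (ih (by omega) ⟨hP x hxP y, hK s (by omega) x hxK y⟩)
  exact hPI (by simpa [hKk] using this k le_rfl)

theorem IsNilpotent.exists_isotropic_succ [FiniteDimensional F L] {A : SAAStruct F L}
    (hA : A.IsNilpotent) {I : Submodule F L} (hI : A.IsIdealSub I) (hiso : A.Isotropic I)
    (hdim : 2 * Module.finrank F I < Module.finrank F L) :
    ∃ I' : Submodule F L, I < I' ∧ Module.finrank F I' = Module.finrank F I + 1 ∧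
      A.Isotropic I' ∧ ∀ x ∈ I', ∀ y, A.mul x y ∈ I := by
  have hPI : ¬ A.perp I ≤ I := fun h => by
    have := Submodule.finrank_mono h
    rw [finrank_perp] at this
    omega
  obtain ⟨x, hxP, hxI, hx⟩ := hA.exists_central_mod hI.perp hPI
  have hx0 : x ≠ 0 := fun h => hxI (h ▸ I.zero_mem)
  refine ⟨I ⊔ F ∙ x, ?_, ?_, ?_, ?_⟩
  · refine lt_of_le_of_ne le_sup_left fun h => hxI ?_
    rw [h]
    exact Submodule.mem_sup_right (Submodule.mem_span_singleton_self x)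
  · have := Submodule.finrank_sup_add_finrank_inf_eq I (F ∙ x)
    rwa [disjoint_iff.1 ((Submodule.disjoint_span_singleton' hx0).2 hxI), finrank_bot,
      finrank_span_singleton hx0, add_zero] at this
  · intro u hu v hv
    obtain ⟨i, hi, _, hc, rfl⟩ := Submodule.mem_sup.1 hu
    obtain ⟨c, rfl⟩ := Submodule.mem_span_singleton.1 hc
    obtain ⟨j, hj, _, hd, rfl⟩ := Submodule.mem_sup.1 hv
    obtain ⟨d, rfl⟩ := Submodule.mem_span_singleton.1 hd
    simp [hiso i hi j hj, hxP j hj, A.form_symm_zero (hxP i hi), A.form_alt x]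
  · intro u hu y
    obtain ⟨i, hi, _, hc, rfl⟩ := Submodule.mem_sup.1 hu
    obtain ⟨c, rfl⟩ := Submodule.mem_span_singleton.1 hc
    rw [map_add, map_smul]
    exact I.add_mem (hI i hi y) (I.smul_mem c (hx y))

theorem IsNilpotent.exists_isotropic_chain [FiniteDimensional F L] {A : SAAStruct F L}
    (hA : A.IsNilpotent) {n : ℕ} (hdim : Module.finrank F L = 2 * n) :
    ∃ I : ℕ → Submodule F L, I 0 = ⊥ ∧ (∀ r ≤ n, Module.finrank F (I r) = r) ∧
      (∀ r < n, I r < I (r + 1)) ∧ (∀ r ≤ n, A.Isotropic (I r)) ∧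
      ∀ r < n, ∀ x ∈ I (r + 1), ∀ y, A.mul x y ∈ I r := by
  have step : ∀ I : Submodule F L, ∃ I' : Submodule F L,
      A.IsIdealSub I ∧ A.Isotropic I ∧ Module.finrank F I < n →
      I < I' ∧ Module.finrank F I' = Module.finrank F I + 1 ∧
        A.Isotropic I' ∧ ∀ x ∈ I', ∀ y, A.mul x y ∈ I := fun I => by
    by_cases h : A.IsIdealSub I ∧ A.Isotropic I ∧ Module.finrank F I < n
    · obtain ⟨I', hI'⟩ := hA.exists_isotropic_succ h.1 h.2.1 (by omega)
      exact ⟨I', fun _ => hI'⟩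
    · exact ⟨⊥, fun h' => absurd h' h⟩
  choose f hf using step
  have good : ∀ r ≤ n, A.IsIdealSub (f^[r] ⊥) ∧ A.Isotropic (f^[r] ⊥) ∧
      Module.finrank F (f^[r] ⊥ : Submodule F L) = r := by
    intro r
    induction r with
    | zero => exact fun _ => ⟨by simp [IsIdealSub], by simp [Isotropic], finrank_bot F L⟩
    | succ r ih =>
      intro hr
      obtain ⟨h1, h2, h3⟩ := ih (by omega)
      obtain ⟨h4, h5, h6, h7⟩ := hf _ ⟨h1, h2, by omega⟩
      rw [Function.iterate_succ_apply']
      exact ⟨fun x hx y => h4.le (h7 x hx y), h6, by rw [h5, h3]⟩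
  have next : ∀ r < n, _ := fun r hr =>
    hf (f^[r] ⊥) ⟨(good r hr.le).1, (good r hr.le).2.1, by rw [(good r hr.le).2.2]; exact hr⟩
  refine ⟨fun r => f^[r] ⊥, rfl, fun r hr => (good r hr).2.2, fun r hr => ?_,
    fun r hr => (good r hr).2.1, fun r hr => ?_⟩
  · simp only [Function.iterate_succ_apply']
    exact (next r hr).1
  · simp only [Function.iterate_succ_apply']
    exact (next r hr).2.2.2

/-- If `I` is a hyperplane of a maximal isotropic `I'` and `I' · L ⊆ I`, then `I^⊥` is
abelian. -/
theorem abelianSub_perp [FiniteDimensional F L] (A : SAAStruct F L) {I I' : Submodule F L}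
    (hII' : I ≤ I') (hiso : A.Isotropic I') (hI' : 2 * Module.finrank F I' = Module.finrank F L)
    (hI : Module.finrank F I + 1 = Module.finrank F I')
    (hmul : ∀ x ∈ I', ∀ y, A.mul x y ∈ I) : A.AbelianSub (A.perp I) := by
  have hself : I' = A.perp I' := by
    refine Submodule.eq_of_le_of_finrank_eq hiso.le_perp ?_
    rw [finrank_perp]
    omega
  have hperp : ∀ w ∈ A.perp I, ∀ z, A.mul w z ∈ I' := fun w hw z => by
    rw [hself]
    exact A.mul_mem_perp hmul hw z
  have hzero : ∀ x ∈ I', ∀ w ∈ A.perp I, A.mul x w = 0 := fun x hx w hw =>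
    A.form_nondegen _ fun z => by
      rw [A.cyclic]
      exact hiso _ (hperp w hw z) x hx
  obtain ⟨y, hyP, hyI⟩ : ∃ y ∈ A.perp I, y ∉ I' := by
    by_contra! h
    have := Submodule.finrank_mono (show A.perp I ≤ I' from h)
    rw [finrank_perp] at this
    omega
  have hy0 : y ≠ 0 := fun h => hyI (h ▸ I'.zero_mem)
  have hspan : I' ⊔ F ∙ y = A.perp I := by
    refine Submodule.eq_of_le_of_finrank_eq (sup_le ?_ ?_) ?_
    · exact hiso.le_perp.trans (A.perp_anti hII')
    · rwa [Submodule.span_singleton_le_iff_mem]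
    · have := Submodule.finrank_sup_add_finrank_inf_eq I' (F ∙ y)
      rw [disjoint_iff.1 ((Submodule.disjoint_span_singleton' hy0).2 hyI), finrank_bot,
        finrank_span_singleton hy0, add_zero] at this
      rw [finrank_perp]
      omega
  intro u hu v hv
  have hv' := hv
  rw [← hspan] at hu hv'
  obtain ⟨i, hi, _, hc, rfl⟩ := Submodule.mem_sup.1 hu
  obtain ⟨c, rfl⟩ := Submodule.mem_span_singleton.1 hc
  obtain ⟨j, hj, _, hd, rfl⟩ := Submodule.mem_sup.1 hv'
  obtain ⟨d, rfl⟩ := Submodule.mem_span_singleton.1 hd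
  have hyj : A.mul y j = 0 := by rw [← A.mul_neg, hzero j hj y hyP, neg_zero]
  rw [A.mul.map_add, LinearMap.add_apply, hzero i hi _ hv]
  simp [hyj, A.mul_alt y]

/-- If `U^⊥` is abelian then `U^⊥ · L ⊆ U`. -/
theorem AbelianSub.mul_mem [FiniteDimensional F L] {A : SAAStruct F L} {U : Submodule F L}
    (h : A.AbelianSub (A.perp U)) {w : L} (hw : w ∈ A.perp U) (y : L) : A.mul w y ∈ U := by
  rw [← A.perp_perp U]
  intro v hv
  rw [A.form_mul_right, ← A.mul_neg v y, map_neg, neg_neg, ← A.form_neg, A.form_mul_right,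
    ← A.form_neg, A.cyclic y w v, h w hw v hv]
  simp

end SAAStruct

/-- a nilpotent SAA of dimension `2n ≥ 2` has an ascending chain of
isotropic ideals `0 = I₀ < I₁ < ⋯ < Iₙ` with `dim I_r = r`; moreover if `2n ≥ 6`
then `I_{n−1}^⊥` is abelian and
`0 < I₂ < ⋯ < I_{n−1} < I_{n−1}^⊥ < ⋯ < I₂^⊥ < L` is a central chain, so that
`L` is nilpotent of class at most `2n − 3`. -/
theorem stmt2 (F : Type*) [Field F] (L : Type*) [AddCommGroup L] [Module F L]
    [FiniteDimensional F L] (A : SAAStruct F L) (n : ℕ)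
    (hn : 1 ≤ n) (hdim : Module.finrank F L = 2 * n)
    (hnil : A.IsNilpotent) :
    ∃ I : ℕ → Submodule F L,
      I 0 = ⊥ ∧
      (∀ r ≤ n, Module.finrank F (I r) = r) ∧
      (∀ r < n, I r < I (r + 1)) ∧
      (∀ r ≤ n, A.IsIdealSub (I r)) ∧
      (∀ r ≤ n, A.Isotropic (I r)) ∧
      (3 ≤ n →
        A.AbelianSub (A.perp (I (n - 1))) ∧
        ∃ J : ℕ → Submodule F L,
          J 0 = ⊥ ∧ J (2 * n - 3) = ⊤ ∧
          (∀ s, 1 ≤ s → s ≤ n - 2 → J s = I (s + 1)) ∧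
          (∀ s, n - 1 ≤ s → s ≤ 2 * n - 4 → J s = A.perp (I (2 * n - 2 - s))) ∧
          (∀ s < 2 * n - 3, J s < J (s + 1)) ∧
          A.CentralChain J (2 * n - 3) ∧
          A.nilClass ≤ 2 * n - 3) := by
  obtain ⟨I, hI0, hrank, hlt, hiso, hmul⟩ := hnil.exists_isotropic_chain hdim
  have hideal : ∀ r ≤ n, A.IsIdealSub (I r) := by
    rintro (_ | r) hr x hx y
    · have : x = 0 := by simpa [hI0] using hx
      simp [this]
    · exact (hlt r hr).le (hmul r hr x hx y)
  refine ⟨I, hI0, hrank, hlt, hideal, hiso, fun h3 => ?_⟩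
  have hab : A.AbelianSub (A.perp (I (n - 1))) := by
    have h1 : n - 1 + 1 = n := by omega
    have h2 := hlt (n - 1) (by omega)
    have h4 := hmul (n - 1) (by omega)
    rw [h1] at h2 h4
    refine A.abelianSub_perp h2.le (hiso n le_rfl) ?_ ?_ h4
    · rw [hrank n le_rfl, hdim]
    · rw [hrank n le_rfl, hrank (n - 1) (by omega), h1]
  have hI2 : ∀ x ∈ I 2, ∀ y, A.mul x y = 0 := fun x hx y =>
    A.mul_eq_zero_of_mem_finrank_one (hrank 1 (by omega)) (hmul 1 (by omega) x hx) y
  set J : ℕ → Submodule F L := fun s =>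
    if s = 0 then ⊥ else if s ≤ n - 2 then I (s + 1)
    else if s ≤ 2 * n - 4 then A.perp (I (2 * n - 2 - s)) else ⊤ with hJ
  have J0 : J 0 = ⊥ := if_pos rfl
  have Jlow : ∀ s, 1 ≤ s → s ≤ n - 2 → J s = I (s + 1) := fun s h1 h2 => by
    simp [hJ, show s ≠ 0 by omega, h2]
  have Jhigh : ∀ s, n - 1 ≤ s → s ≤ 2 * n - 4 → J s = A.perp (I (2 * n - 2 - s)) :=
    fun s h1 h2 => by
      simp [hJ, show s ≠ 0 by omega, show ¬ s ≤ n - 2 by omega, h2]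
  have Jtop : J (2 * n - 3) = ⊤ := by
    simp [hJ, show 2 * n - 3 ≠ 0 by omega, show ¬ 2 * n - 3 ≤ n - 2 by omega,
      show ¬ 2 * n - 3 ≤ 2 * n - 4 by omega]
  have Jmul : ∀ s < 2 * n - 3, ∀ x ∈ J (s + 1), ∀ y, A.mul x y ∈ J s := by
    intro s hs x hx y
    rcases Nat.eq_zero_or_pos s with rfl | hs0
    · rw [Jlow _ le_rfl (by omega)] at hx
      rw [hI2 x hx y]
      exact zero_mem _
    rcases lt_trichotomy s (n - 2) with hs2 | hs2 | hs2
    · rw [Jlow _ (by omega) (by omega)] at hx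
      rw [Jlow _ hs0 hs2.le]
      exact hmul _ (by omega) x hx y
    · rw [Jhigh _ (by omega) (by omega), show 2 * n - 2 - (s + 1) = n - 1 by omega] at hx
      rw [Jlow _ hs0 hs2.le, show s + 1 = n - 1 by omega]
      exact hab.mul_mem hx y
    · rw [Jhigh _ (by omega) (by omega)]
      rcases Nat.lt_or_ge s (2 * n - 4) with hs4 | hs4
      · rw [Jhigh _ (by omega) (by omega)] at hx
        refine A.mul_mem_perp (fun v hv z => hmul _ (by omega) v ?_ z) hx y
        rwa [show 2 * n - 2 - (s + 1) + 1 = 2 * n - 2 - s by omega]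
      · rw [show 2 * n - 2 - s = 2 by omega]
        refine A.mul_mem_perp (U := ⊥) (fun v hv z => by simp [hI2 v hv z]) ?_ y
        intro u hu
        simp [(Submodule.mem_bot F).1 hu]
  have Jlt : ∀ s < 2 * n - 3, J s < J (s + 1) := by
    have rank_low : ∀ s, 1 ≤ s → s ≤ n - 2 → Module.finrank F (J s) = s + 1 :=
      fun s h1 h2 => by rw [Jlow s h1 h2, hrank _ (by omega)]
    have rank_high : ∀ s, n - 1 ≤ s → s ≤ 2 * n - 4 → Module.finrank F (J s) = s + 2 :=
      fun s h1 h2 => by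
        rw [Jhigh s h1 h2, A.finrank_perp, hdim, hrank _ (by omega)]
        omega
    intro s hs
    rcases Nat.eq_zero_or_pos s with rfl | hs0
    · rw [J0, bot_lt_iff_ne_bot]
      intro h
      have := rank_low 1 le_rfl (by omega)
      rw [zero_add] at h
      rw [h, finrank_bot] at this
      omega
    rcases lt_trichotomy s (n - 2) with hs2 | hs2 | hs2
    · rw [Jlow s hs0 hs2.le, Jlow (s + 1) (by omega) (by omega)]
      exact hlt _ (by omega)
    · refine lt_of_le_of_ne ?_ fun h => ?_
      · rw [Jhigh (s + 1) (by omega) (by omega), show 2 * n - 2 - (s + 1) = n - 1 by omega,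
          Jlow _ hs0 hs2.le, show s + 1 = n - 1 by omega]
        exact (hiso _ (by omega)).le_perp
      · have h1 := rank_low s hs0 hs2.le
        rw [h, rank_high (s + 1) (by omega) (by omega)] at h1
        omega
    · rcases Nat.lt_or_ge s (2 * n - 4) with hs4 | hs4
      · refine lt_of_le_of_ne ?_ fun h => ?_
        · rw [Jhigh s (by omega) (by omega), Jhigh (s + 1) (by omega) (by omega)]
          refine A.perp_anti ?_
          rw [show 2 * n - 2 - s = 2 * n - 2 - (s + 1) + 1 by omega]
          exact (hlt _ (by omega)).le
        · have h1 := rank_high s (by omega) hs4.le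
          rw [h, rank_high (s + 1) (by omega) (by omega)] at h1
          omega
      · rw [show s + 1 = 2 * n - 3 by omega, Jtop, lt_top_iff_ne_top]
        intro h
        have h1 := rank_high s (by omega) (by omega)
        rw [h, finrank_top, hdim] at h1
        omega
  have Jchain : A.CentralChain J (2 * n - 3) := by
    refine ⟨J0, Jtop, fun s hs => (Jlt s hs).le, ?_, Jmul⟩
    rintro (_ | s) hs x hx y
    · have : x = 0 := by simpa [J0] using hx
      simp [this]
    · exact (Jlt s hs).le (Jmul s hs x hx y)
  exact ⟨hab, J, J0, Jtop, Jlow, Jhigh, Jlt, Jchain, Nat.sInf_le ⟨J, Jchain⟩⟩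
end

section
/- Let F be a field and let m, n be natural numbers with 2n ≥ 8 and (Ω(m)+Ω(m+1))/2 < n ≤ Ω(m+1). Then there exists a nilpotent symplectic alternating algebra L of dimension 2n over F with dim Z(L) = 2 whose nilpotency class is exactly 2m+2. -/
/-- A symplectic alternating algebra over `F`, bundled with its carrier space. -/
structure SAABundle (F : Type) [Field F] where
  carrier : Type
  [grp : AddCommGroup carrier]
  [mod : Module F carrier]
  alg : SAAStruct F carrier

attribute [instance] SAABundle.grp SAABundle.mod

theorem SAAStruct.mul_skew {F L : Type*} [Field F] [AddCommGroup L] [Module F L]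
    (A : SAAStruct F L) (x y : L) : A.mul x y = -A.mul y x :=
  (LinearMap.IsAlt.neg (B := A.mul) A.mul_alt y x).symm

theorem SAAStruct.form_skew {F L : Type*} [Field F] [AddCommGroup L] [Module F L]
    (A : SAAStruct F L) (x y : L) : A.form x y = -A.form y x :=
  (LinearMap.IsAlt.neg (B := A.form) A.form_alt y x).symm

namespace SAAStruct

variable {F L : Type*} [Field F] [AddCommGroup L] [Module F L] (A : SAAStruct F L)

theorem mem_ucs_succ {i : ℕ} {x : L} : x ∈ A.ucs (i + 1) ↔ ∀ y, A.mul x y ∈ A.ucs i := Iff.rfl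

theorem mem_perp {U : Submodule F L} {x : L} : x ∈ A.perp U ↔ ∀ u ∈ U, A.form x u = 0 := Iff.rfl

theorem mul_mem_lcs {i : ℕ} {u : L} (hu : u ∈ A.lcs i) (v : L) : A.mul u v ∈ A.lcs (i + 1) :=
  Submodule.subset_span ⟨u, hu, v, rfl⟩

theorem ucs_le_succ (i : ℕ) : A.ucs i ≤ A.ucs (i + 1) := by
  induction i with
  | zero => exact bot_le
  | succ i ih => exact fun x hx y => ih (hx y)

theorem ucs_monotone : Monotone A.ucs := monotone_nat_of_le_succ A.ucs_le_succ

theorem center_eq_ucs_one : A.center = A.ucs 1 := by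
  ext x
  constructor
  · intro hx y
    have : A.mul x = 0 := hx
    simp [this]
  · intro hx
    exact LinearMap.ext fun y => by simpa [ucs] using hx y

theorem ucs_centralChain {k : ℕ} (hk : A.ucs k = ⊤) : A.CentralChain A.ucs k := by
  refine ⟨rfl, hk, fun s _ => A.ucs_le_succ s, fun s _ x hx y => ?_, fun s _ x hx y => hx y⟩
  exact A.ucs_le_succ s hx y

theorem CentralChain.le_ucs {A : SAAStruct F L} {I : ℕ → Submodule F L} {k : ℕ}
    (h : A.CentralChain I k) : ∀ i ≤ k, I i ≤ A.ucs i := by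
  intro i
  induction i with
  | zero => exact fun _ => h.1.le
  | succ i ih => exact fun hi x hx y => ih (by omega) (h.2.2.2.2 i (by omega) x hx y)

theorem CentralChain.ucs_eq_top {A : SAAStruct F L} {I : ℕ → Submodule F L} {k : ℕ}
    (h : A.CentralChain I k) : A.ucs k = ⊤ :=
  top_le_iff.1 (h.2.1 ▸ h.le_ucs k le_rfl)

theorem lcs_succ_le_ucs_iff {i j : ℕ} : A.lcs (j + 1) ≤ A.ucs i ↔ A.lcs j ≤ A.ucs (i + 1) := by
  constructor
  · exact fun h x hx y => h (A.mul_mem_lcs hx y)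
  · intro h
    refine Submodule.span_le.2 ?_
    rintro _ ⟨u, hu, v, rfl⟩
    exact h hu v

theorem lcs_le_ucs_iff {i j : ℕ} : A.lcs j ≤ A.ucs i ↔ A.ucs (i + j) = ⊤ := by
  induction j generalizing i with
  | zero => exact top_le_iff
  | succ j ih => rw [lcs_succ_le_ucs_iff, ih, Nat.add_right_comm, Nat.add_assoc]

theorem form_mul_comm (x u v : L) : A.form x (A.mul u v) = A.form (A.mul x v) u := by
  rw [A.form_skew, A.mul_skew x v, A.cyclic u v x]
  simp

theorem perp_lcs (i : ℕ) : A.perp (A.lcs i) = A.ucs i := by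
  induction i with
  | zero =>
    refine le_bot_iff.1 fun x hx => ?_
    exact A.form_nondegen x fun y => hx y trivial
  | succ i ih =>
    ext x
    rw [mem_ucs_succ, ← ih]
    constructor
    · intro hx y u hu
      rw [← A.form_mul_comm]
      exact hx _ (A.mul_mem_lcs hu y)
    · intro hx
      have : A.lcs (i + 1) ≤ LinearMap.ker (A.form x) := by
        refine Submodule.span_le.2 ?_
        rintro _ ⟨u, hu, v, rfl⟩
        exact (A.form_mul_comm x u v).trans (hx v u hu)
      exact fun u hu => this hu

theorem finrank_ucs_add_finrank_lcs [FiniteDimensional F L] (i : ℕ) :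
    Module.finrank F (A.ucs i) + Module.finrank F (A.lcs i) = Module.finrank F L := by
  have halt : LinearMap.BilinForm.IsAlt A.form := A.form_alt
  have hnd : LinearMap.BilinForm.Nondegenerate A.form := by
    refine (LinearMap.IsRefl.nondegenerate_iff_separatingLeft halt.isRefl).2 A.form_nondegen
  have h := LinearMap.BilinForm.finrank_orthogonal hnd (A.lcs i)
  have he : LinearMap.BilinForm.orthogonal A.form (A.lcs i) = A.ucs i := by
    rw [← A.perp_lcs]
    ext x
    rw [LinearMap.BilinForm.mem_orthogonal_iff, mem_perp]
    refine forall₂_congr fun u _ => ?_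
    rw [A.form_skew u x, neg_eq_zero]
  have := Submodule.finrank_le (A.lcs i)
  rw [he] at h
  omega

theorem finrank_ucs_succ_le [FiniteDimensional F L] (i : ℕ) :
    Module.finrank F (A.ucs (i + 1)) ≤
      Module.finrank F A.center + (Module.finrank F (A.ucs i)).choose 2 := by
  obtain ⟨W, hW⟩ := Submodule.exists_isCompl (A.lcs i)
  have hd : Module.finrank F W = Module.finrank F (A.ucs i) := by
    have h1 := Submodule.finrank_add_eq_of_isCompl hW
    have h2 := A.finrank_ucs_add_finrank_lcs i
    omega
  let w := Module.finBasis F W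
  let f : A.ucs (i + 1) →ₗ[F]
      ((Σ b : Fin (Module.finrank F W), Fin b) → F) :=
    LinearMap.pi fun p =>
      (LinearMap.applyₗ (w p.1 : L)) ∘ₗ A.form ∘ₗ
        (LinearMap.applyₗ (w (p.2.castLE p.1.2.le) : L)) ∘ₗ A.mul ∘ₗ (A.ucs (i + 1)).subtype
  have hcard : Fintype.card (Σ b : Fin (Module.finrank F W), Fin b) =
      (Module.finrank F (A.ucs i)).choose 2 := by
    simp only [Fintype.card_sigma, Fintype.card_fin]
    rw [Fin.sum_univ_eq_sum_range (fun b => b), Finset.sum_range_id, Nat.choose_two_right, hd]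
  have hker : (LinearMap.ker f).map (A.ucs (i + 1)).subtype ≤ A.center := by
    rintro _ ⟨x, hx, rfl⟩
    have hx0 : ∀ a b, a < b → A.form (A.mul x (w a)) (w b) = 0 := fun a b hab =>
      congrFun (LinearMap.mem_ker.1 hx) ⟨b, ⟨a, hab⟩⟩
    have hskew : ∀ u v, A.form (A.mul x u) v = -A.form (A.mul x v) u := fun u v => by
      rw [← A.form_mul_comm, ← A.form_mul_comm, A.mul_skew]; simp
    have hw : ∀ a b, A.form (A.mul x (w a)) (w b) = 0 := by
      intro a b
      rcases lt_trichotomy a b with h | h | h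
      · exact hx0 a b h
      · rw [h, ← A.form_mul_comm, A.mul_alt, map_zero]
      · rw [hskew, hx0 b a h, neg_zero]
    have hlcs : ∀ u, ∀ v ∈ A.lcs i, A.form (A.mul x u) v = 0 := by
      intro u v hv
      have := x.2 u
      rw [← A.perp_lcs] at this
      exact this v hv
    have hWr : ∀ a, ∀ v ∈ W, A.form (A.mul x (w a)) v = 0 := by
      intro a
      have : A.form (A.mul x (w a)) ∘ₗ W.subtype = 0 := w.ext fun b => hw a b
      exact fun v hv => LinearMap.congr_fun this ⟨v, hv⟩
    have hWW : ∀ u ∈ W, ∀ v ∈ W, A.form (A.mul x u) v = 0 := by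
      intro u hu v hv
      rw [hskew]
      have : A.form (A.mul x v) ∘ₗ W.subtype = 0 := w.ext fun b => by
        have := hWr b v hv
        rw [hskew] at this
        simpa using this
      simpa using LinearMap.congr_fun this ⟨u, hu⟩
    refine LinearMap.mem_ker.2 (LinearMap.ext fun u => A.form_nondegen _ fun v => ?_)
    obtain ⟨u₁, hu₁, u₂, hu₂, rfl⟩ :=
      Submodule.mem_sup.1 (hW.sup_eq_top ▸ Submodule.mem_top : u ∈ A.lcs i ⊔ W)
    obtain ⟨v₁, hv₁, v₂, hv₂, rfl⟩ :=
      Submodule.mem_sup.1 (hW.sup_eq_top ▸ Submodule.mem_top : v ∈ A.lcs i ⊔ W)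
    simp only [Submodule.subtype_apply, map_add, LinearMap.add_apply, hlcs _ _ hv₁, hWW _ hu₂ _ hv₂]
    rw [hskew, hlcs _ _ hu₁]
    simp
  have h1 := LinearMap.finrank_range_add_finrank_ker f
  have h2 := Submodule.finrank_le (LinearMap.range f)
  have h3 := Submodule.finrank_mono hker
  rw [Submodule.finrank_map_subtype_eq] at h3
  rw [Module.finrank_fintype_fun_eq_card, hcard] at h2
  omega

theorem finrank_ucs_le_OmegaFn [FiniteDimensional F L] (hc : Module.finrank F A.center = 2)
    (i : ℕ) : Module.finrank F (A.ucs i) ≤ OmegaFn i := by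
  induction i with
  | zero => exact (finrank_bot F L).le
  | succ i ih =>
    have := A.finrank_ucs_succ_le i
    have := Nat.choose_le_choose 2 ih
    simp only [OmegaFn]
    omega

/-- If the center is two-dimensional and the dimension exceeds `Ω m + Ω (m + 1)`, the upper
central series takes more than `2m + 1` steps. -/
theorem CentralChain.two_mul_add_two_le [FiniteDimensional F L] {A : SAAStruct F L}
    (hc : Module.finrank F A.center = 2) {m k : ℕ}
    (hdim : OmegaFn m + OmegaFn (m + 1) < Module.finrank F L) {I : ℕ → Submodule F L}
    (h : A.CentralChain I k) : 2 * m + 2 ≤ k := by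
  by_contra! hk
  have htop : A.ucs (m + 1 + m) = ⊤ :=
    top_le_iff.1 (h.ucs_eq_top ▸ A.ucs_monotone (by omega))
  have h1 := Submodule.finrank_mono (A.lcs_le_ucs_iff.2 htop)
  have h2 := A.finrank_ucs_add_finrank_lcs m
  have h3 := A.finrank_ucs_le_OmegaFn hc m
  have h4 := A.finrank_ucs_le_OmegaFn hc (m + 1)
  omega

/-- The symplectic alternating algebra whose trilinear form `(u·v, w)` is the sum of the
decomposable forms `(p, -) ∧ (q, -) ∧ (r, -)` over a finite family of triples `p, q, r`. -/
def ofTriples (B : L →ₗ[F] L →ₗ[F] F) (hB : ∀ x, B x x = 0)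
    (hB' : ∀ x, (∀ y, B x y = 0) → x = 0) {ι : Type*} (s : Finset ι) (p q r : ι → L) :
    SAAStruct F L where
  form := B
  form_alt := hB
  form_nondegen := hB'
  mul := LinearMap.mk₂ F
    (fun u v => ∑ i ∈ s, ((B (q i) u * B (r i) v - B (r i) u * B (q i) v) • p i +
      (B (r i) u * B (p i) v - B (p i) u * B (r i) v) • q i +
      (B (p i) u * B (q i) v - B (q i) u * B (p i) v) • r i))
    (fun u u' v => by
      rw [← Finset.sum_add_distrib]
      refine Finset.sum_congr rfl fun i _ => ?_
      simp only [map_add]; module)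
    (fun c u v => by
      rw [Finset.smul_sum]
      refine Finset.sum_congr rfl fun i _ => ?_
      simp only [map_smul, smul_eq_mul]; module)
    (fun u v v' => by
      rw [← Finset.sum_add_distrib]
      refine Finset.sum_congr rfl fun i _ => ?_
      simp only [map_add]; module)
    (fun c u v => by
      rw [Finset.smul_sum]
      refine Finset.sum_congr rfl fun i _ => ?_
      simp only [map_smul, smul_eq_mul]; module)
  mul_alt x := by
    rw [LinearMap.mk₂_apply]
    refine Finset.sum_eq_zero fun i _ => ?_
    module
  cyclic x y z := by
    simp only [LinearMap.mk₂_apply, map_sum, LinearMap.sum_apply]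
    refine Finset.sum_congr rfl fun i _ => ?_
    simp only [map_add, map_smul, LinearMap.add_apply, LinearMap.smul_apply, smul_eq_mul]
    ring

theorem ofTriples_mul (B : L →ₗ[F] L →ₗ[F] F) (hB : ∀ x, B x x = 0)
    (hB' : ∀ x, (∀ y, B x y = 0) → x = 0) {ι : Type*} (s : Finset ι) (p q r : ι → L) (u v : L) :
    (ofTriples B hB hB' s p q r).mul u v =
      ∑ i ∈ s, ((B (q i) u * B (r i) v - B (r i) u * B (q i) v) • p i +
        (B (r i) u * B (p i) v - B (p i) u * B (r i) v) • q i +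
        (B (p i) u * B (q i) v - B (q i) u * B (p i) v) • r i) := rfl

theorem ofTriples_form_mul (B : L →ₗ[F] L →ₗ[F] F) (hB : ∀ x, B x x = 0)
    (hB' : ∀ x, (∀ y, B x y = 0) → x = 0) {ι : Type*} (s : Finset ι) (p q r : ι → L)
    (u v w : L) :
    B ((ofTriples B hB hB' s p q r).mul u v) w =
      ∑ i ∈ s, ((B (q i) u * B (r i) v - B (r i) u * B (q i) v) * B (p i) w +
        (B (r i) u * B (p i) v - B (p i) u * B (r i) v) * B (q i) w +
        (B (p i) u * B (q i) v - B (q i) u * B (p i) v) * B (r i) w) := by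
  simp [ofTriples_mul, map_sum, LinearMap.sum_apply]

end SAAStruct

theorem exists_eq_choose_two_add (k : ℕ) :
    ∃ p : ℕ × ℕ, p.1 < p.2 ∧ k = p.2.choose 2 + p.1 := by
  induction k with
  | zero => exact ⟨(0, 1), by simp, by simp⟩
  | succ k ih =>
    obtain ⟨⟨a, b⟩, hab, hk⟩ := ih
    simp only at hab hk
    by_cases h : a + 1 < b
    · exact ⟨(a + 1, b), h, by simp only; omega⟩
    · refine ⟨(0, b + 1), by simp, ?_⟩
      have : (b + 1).choose 2 = b.choose 1 + b.choose 2 := rfl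
      simp only [Nat.choose_one_right] at this ⊢
      omega

/-- The pair `(a, b)` with `a < b` and `k = C(b, 2) + a`. -/
noncomputable def colexPair (k : ℕ) : ℕ × ℕ := (exists_eq_choose_two_add k).choose

theorem colexPair_lt (k : ℕ) : (colexPair k).1 < (colexPair k).2 :=
  (exists_eq_choose_two_add k).choose_spec.1

theorem colexPair_spec (k : ℕ) : k = (colexPair k).2.choose 2 + (colexPair k).1 :=
  (exists_eq_choose_two_add k).choose_spec.2

theorem succ_choose_two (b : ℕ) : (b + 1).choose 2 = b + b.choose 2 := by
  rw [Nat.choose_succ_succ' b 1, Nat.choose_one_right]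

theorem colexPair_choose_two_add {a b : ℕ} (h : a < b) :
    colexPair (b.choose 2 + a) = (a, b) := by
  have h1 := colexPair_lt (b.choose 2 + a)
  have h2 := colexPair_spec (b.choose 2 + a)
  generalize colexPair (b.choose 2 + a) = p at h1 h2 ⊢
  obtain ⟨a', b'⟩ := p
  dsimp only at h1 h2
  have h3 := succ_choose_two b
  have h4 := succ_choose_two b'
  rcases lt_trichotomy b b' with hb | hb | hb
  · have := Nat.choose_le_choose 2 (Nat.add_one_le_iff.2 hb)
    omega
  · subst hb
    simp only [Prod.mk.injEq, and_true]
    omega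
  · have := Nat.choose_le_choose 2 (Nat.add_one_le_iff.2 hb)
    omega

theorem colexPair_snd_lt {k d : ℕ} (h : k < d.choose 2) : (colexPair k).2 < d := by
  by_contra! hd
  have := Nat.choose_le_choose 2 hd
  have := colexPair_spec k
  omega

theorem le_choose_two_add_one (b : ℕ) : b ≤ b.choose 2 + 1 := by
  induction b with
  | zero => omega
  | succ b ih =>
    rw [succ_choose_two]
    rcases b with _ | b
    · omega
    · rw [succ_choose_two] at ih ⊢
      omega

theorem colexPair_snd_le (k : ℕ) : (colexPair k).2 ≤ k + 1 := by
  have := le_choose_two_add_one (colexPair k).2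
  have := colexPair_spec k
  omega

namespace StdSymplectic

variable (F : Type) [Field F] (n : ℕ)

/-- The standard symplectic form on `Fⁿ × Fⁿ`. -/
def stdForm : ((Fin n → F) × (Fin n → F)) →ₗ[F] ((Fin n → F) × (Fin n → F)) →ₗ[F] F :=
  LinearMap.mk₂ F (fun u v => u.1 ⬝ᵥ v.2 - u.2 ⬝ᵥ v.1)
    (fun u u' v => by simp; ring) (fun c u v => by simp; ring)
    (fun u v v' => by simp; ring) (fun c u v => by simp; ring)

theorem stdForm_apply (u v : (Fin n → F) × (Fin n → F)) :
    stdForm F n u v = u.1 ⬝ᵥ v.2 - u.2 ⬝ᵥ v.1 := rfl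

/-- The standard basis vector `xᵢ`, for `i < n`, and `0` for `i ≥ n`. -/
def X (i : ℕ) : (Fin n → F) × (Fin n → F) :=
  if h : i < n then (Pi.single ⟨i, h⟩ 1, 0) else 0

/-- The standard basis vector `yᵢ`, for `i < n`, and `0` for `i ≥ n`. -/
def Y (i : ℕ) : (Fin n → F) × (Fin n → F) :=
  if h : i < n then (0, Pi.single ⟨i, h⟩ 1) else 0

theorem stdForm_X {i : ℕ} (h : i < n) (u : (Fin n → F) × (Fin n → F)) :
    stdForm F n (X F n i) u = u.2 ⟨i, h⟩ := by
  simp [stdForm_apply, X, h]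

theorem stdForm_Y {i : ℕ} (h : i < n) (u : (Fin n → F) × (Fin n → F)) :
    stdForm F n (Y F n i) u = -u.1 ⟨i, h⟩ := by
  simp [stdForm_apply, Y, h]

theorem stdForm_X_X (i j : ℕ) : stdForm F n (X F n i) (X F n j) = 0 := by
  simp only [stdForm_apply, X]; split_ifs <;> simp

theorem stdForm_Y_Y (i j : ℕ) : stdForm F n (Y F n i) (Y F n j) = 0 := by
  simp only [stdForm_apply, Y]; split_ifs <;> simp

theorem stdForm_X_Y {i : ℕ} (h : i < n) (j : ℕ) :
    stdForm F n (X F n i) (Y F n j) = if i = j then 1 else 0 := by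
  rw [stdForm_X F n h, Y]
  by_cases hj : j < n
  · simp [hj, Pi.single_apply]
  · have : i ≠ j := by omega
    simp [hj, this]

theorem stdForm_Y_X {i : ℕ} (h : i < n) (j : ℕ) :
    stdForm F n (Y F n i) (X F n j) = if i = j then -1 else 0 := by
  rw [stdForm_Y F n h, X]
  by_cases hj : j < n
  · by_cases hij : i = j <;> simp [hj, hij]
  · have : i ≠ j := by omega
    simp [hj, this]

theorem stdForm_self (u : (Fin n → F) × (Fin n → F)) : stdForm F n u u = 0 := by
  rw [stdForm_apply, dotProduct_comm, sub_self]

theorem stdForm_nondegen (u : (Fin n → F) × (Fin n → F)) (h : ∀ v, stdForm F n u v = 0) :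
    u = 0 := by
  have h' : ∀ v, stdForm F n v u = 0 := fun v => by
    have := h v
    rw [stdForm_apply] at this ⊢
    rw [dotProduct_comm v.1, dotProduct_comm v.2]
    linear_combination -this
  ext i
  · have := h' (Y F n i)
    rw [stdForm_Y F n i.2] at this
    simpa using this
  · have := h' (X F n i)
    rw [stdForm_X F n i.2] at this
    simpa using this

/-- The algebra on `Fⁿ × Fⁿ` with trilinear form
`∑ yₖ ∧ x_a ∧ x_b + ∑ x_ε ∧ xₖ ∧ xₖ₊₁`, where `(a, b)` is the pair numbered `k - 2` and `ε` is the
parity of `k`. -/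
noncomputable def colexAlgebra : SAAStruct F ((Fin n → F) × (Fin n → F)) :=
  .ofTriples (stdForm F n) (stdForm_self F n) (stdForm_nondegen F n)
    ((Finset.Ico 2 n).disjSum (Finset.Ico 2 (n - 1)))
    (Sum.elim (fun k => Y F n k) (fun k => X F n (k % 2)))
    (Sum.elim (fun k => X F n (colexPair (k - 2)).1) (fun k => X F n k))
    (Sum.elim (fun k => X F n (colexPair (k - 2)).2) (fun k => X F n (k + 1)))

theorem X_mem_ucs (i k : ℕ) (hk : k < OmegaFn i) : X F n k ∈ (colexAlgebra F n).ucs i := by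
  induction i generalizing k with
  | zero => simp [OmegaFn] at hk
  | succ i ih =>
    intro v
    rw [colexAlgebra, SAAStruct.ofTriples_mul, Finset.sum_disjSum]
    refine Submodule.add_mem _ (Submodule.sum_mem _ fun j hj => ?_)
      (Submodule.sum_mem _ fun j hj => ?_)
    · obtain ⟨hj2, hjn⟩ := Finset.mem_Ico.1 hj
      simp only [Sum.elim_inl, stdForm_X_X, stdForm_Y_X F n hjn]
      split_ifs with h
      · subst h
        have hb : (colexPair (j - 2)).2 < OmegaFn i :=
          colexPair_snd_lt (by simp only [OmegaFn] at hk; omega)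
        have ha := (colexPair_lt (j - 2)).trans hb
        have hA := ih _ ha
        have hB := ih _ hb
        rw [colexAlgebra] at hA hB
        refine Submodule.add_mem _ (Submodule.add_mem _ ?_ (Submodule.smul_mem _ _ hA))
          (Submodule.smul_mem _ _ hB)
        simp
      · simp
    · simp only [Sum.elim_inr, stdForm_X_X]
      simp

theorem lcs_le_ucs {i : ℕ} (h : n ≤ OmegaFn i) :
    (colexAlgebra F n).lcs i ≤ (colexAlgebra F n).ucs i := by
  intro u hu
  have h2 : u.2 = 0 := by
    funext k
    have := X_mem_ucs F n i k (by omega)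
    rw [← SAAStruct.perp_lcs] at this
    have := this u hu
    rwa [colexAlgebra, SAAStruct.ofTriples, stdForm_X F n k.2] at this
  have : u = ∑ k : Fin n, u.1 k • X F n k := by
    ext k
    · simp [X, Prod.fst_sum, Finset.sum_apply, Pi.single_apply]
    · simp [X, Prod.snd_sum, Finset.sum_apply, h2]
  rw [this]
  exact Submodule.sum_mem _ fun k _ => Submodule.smul_mem _ _ (X_mem_ucs F n i k (by omega))

variable {F n}

theorem stdForm_X_colexPair_of_mem_center {z : (Fin n → F) × (Fin n → F)}
    (hz : z ∈ (colexAlgebra F n).center) {j : ℕ} (hj2 : 2 ≤ j) (hjn : j < n) :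
    stdForm F n (X F n (colexPair (j - 2)).1) z = 0 ∧
      stdForm F n (X F n (colexPair (j - 2)).2) z = 0 := by
  have hz' : (colexAlgebra F n).mul z = 0 := hz
  have key : ∀ c, c < n →
      stdForm F n (X F n (colexPair (j - 2)).1) z *
          (if (colexPair (j - 2)).2 = c then 1 else 0) -
        stdForm F n (X F n (colexPair (j - 2)).2) z *
          (if (colexPair (j - 2)).1 = c then 1 else 0) = 0 := by
    intro c hc
    have h : stdForm F n ((colexAlgebra F n).mul z (X F n j)) (Y F n c) = 0 := by simp [hz']
    rw [colexAlgebra, SAAStruct.ofTriples_form_mul, Finset.sum_disjSum] at h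
    rw [Finset.sum_eq_zero (s := Finset.Ico 2 (n - 1)), add_zero,
      Finset.sum_eq_single_of_mem j (Finset.mem_Ico.2 ⟨hj2, hjn⟩)] at h
    · have hb : (colexPair (j - 2)).2 < n := by have := colexPair_snd_le (j - 2); omega
      have ha := (colexPair_lt (j - 2)).trans hb
      simp only [Sum.elim_inl, stdForm_X_X, stdForm_Y_X F n hjn, stdForm_X_Y F n ha,
        stdForm_X_Y F n hb, stdForm_Y_Y, if_true] at h
      linear_combination h
    · intro k hk hkj
      simp [stdForm_X_X, stdForm_Y_X F n (Finset.mem_Ico.1 hk).2, hkj]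
    · intro k hk
      simp [stdForm_X_X]
  have hlt := colexPair_lt (j - 2)
  have hb : (colexPair (j - 2)).2 < n := by have := colexPair_snd_le (j - 2); omega
  constructor
  · simpa [hlt.ne] using key _ hb
  · simpa [hlt.ne'] using key _ (hlt.trans hb)

theorem stdForm_X_zero_one_of_mem_center (hn : 5 ≤ n) {z : (Fin n → F) × (Fin n → F)}
    (hz : z ∈ (colexAlgebra F n).center) {c : ℕ} (hc : c < 2) :
    stdForm F n (X F n c) z = 0 := by
  have h := stdForm_X_colexPair_of_mem_center hz le_rfl (by omega)
  have hp : colexPair (2 - 2) = (0, 1) := colexPair_choose_two_add (a := 0) (b := 1) (by omega)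
  rw [hp] at h
  interval_cases c
  · exact h.1
  · exact h.2

theorem sum_eq_zero_of_mem_center (hn : 5 ≤ n) {z : (Fin n → F) × (Fin n → F)}
    (hz : z ∈ (colexAlgebra F n).center) {a b : ℕ} (hab : a < b) :
    (∑ k ∈ Finset.Ico 2 n, if colexPair (k - 2) = (a, b) then stdForm F n (Y F n k) z else 0) +
      (∑ k ∈ Finset.Ico 2 (n - 1),
        ((if k % 2 = a ∧ k = b then stdForm F n (X F n (k + 1)) z else 0) -
          if k % 2 = a ∧ k + 1 = b then stdForm F n (X F n k) z else 0)) = 0 := by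
  have hz' : (colexAlgebra F n).mul z = 0 := hz
  have h : stdForm F n ((colexAlgebra F n).mul z (Y F n a)) (Y F n b) = 0 := by simp [hz']
  rw [colexAlgebra, SAAStruct.ofTriples_form_mul, Finset.sum_disjSum] at h
  refine Eq.trans ?_ h
  congr 1
  · refine Finset.sum_congr rfl fun k hk => ?_
    obtain ⟨hk2, hkn⟩ := Finset.mem_Ico.1 hk
    have hB : (colexPair (k - 2)).2 < n := by have := colexPair_snd_le (k - 2); omega
    have hA := (colexPair_lt (k - 2)).trans hB
    have hlt := colexPair_lt (k - 2)
    simp only [Sum.elim_inl, stdForm_Y_Y, stdForm_X_Y F n hA, stdForm_X_Y F n hB, Prod.ext_iff]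
    split_ifs <;> first | omega | simp
  · refine Finset.sum_congr rfl fun k hk => ?_
    obtain ⟨hk2, hkn⟩ := Finset.mem_Ico.1 hk
    have h01 := stdForm_X_zero_one_of_mem_center hn hz (c := k % 2) (by omega)
    simp only [Sum.elim_inr, h01, stdForm_X_Y F n (show k < n by omega),
      stdForm_X_Y F n (show k + 1 < n by omega), stdForm_X_Y F n (show k % 2 < n by omega)]
    split_ifs <;> first | omega | simp

theorem snd_eq_zero_of_mem_center (hn : 5 ≤ n) {z : (Fin n → F) × (Fin n → F)}
    (hz : z ∈ (colexAlgebra F n).center) {k : ℕ} (hk : k < n) :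
    stdForm F n (X F n k) z = 0 := by
  have hvanish : ∀ a b, a < b → n ≤ b.choose 2 + a + 2 →
      (∑ k ∈ Finset.Ico 2 n,
        if colexPair (k - 2) = (a, b) then stdForm F n (Y F n k) z else 0) = 0 := by
    intro a b _ h
    refine Finset.sum_eq_zero fun k hk => if_neg fun he => ?_
    have := colexPair_spec (k - 2)
    have := Finset.mem_Ico.1 hk
    simp only [he] at *
    omega
  rcases lt_or_ge k 2 with h2 | h2
  · exact stdForm_X_zero_one_of_mem_center hn hz h2
  by_cases hkc : 2 + k.choose 2 < n
  · have h := (stdForm_X_colexPair_of_mem_center hz (j := k.choose 2 + 0 + 2)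
      (by omega) (by omega)).2
    rwa [Nat.add_sub_cancel, colexPair_choose_two_add (by omega)] at h
  by_cases hkn : k + 1 < n
  · have h := sum_eq_zero_of_mem_center hn hz (a := k % 2) (b := k + 1) (by omega)
    rw [hvanish _ _ (by omega) (by rw [succ_choose_two]; omega), zero_add,
      Finset.sum_eq_single_of_mem k (Finset.mem_Ico.2 ⟨h2, by omega⟩)] at h
    · simpa using h
    · intro i hi hik
      have := Finset.mem_Ico.1 hi
      rw [if_neg (by omega), if_neg (by omega), sub_zero]
  · obtain ⟨j, rfl⟩ : ∃ j, k = j + 1 := ⟨k - 1, by omega⟩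
    have hj : j + 1 ≤ j.choose 2 + 1 := by
      obtain ⟨l, rfl⟩ : ∃ l, j = l + 1 := ⟨j - 1, by omega⟩
      have := le_choose_two_add_one l
      rw [succ_choose_two]
      rcases l with _ | _ | l
      · omega
      · omega
      · rw [succ_choose_two, succ_choose_two]; omega
    have h := sum_eq_zero_of_mem_center hn hz (a := j % 2) (b := j) (by omega)
    rw [hvanish _ _ (by omega) (by omega), zero_add,
      Finset.sum_eq_single_of_mem j (Finset.mem_Ico.2 ⟨by omega, by omega⟩)] at h
    · simpa using h
    · intro i hi hik
      have := Finset.mem_Ico.1 hi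
      rw [if_neg (by omega), if_neg (by omega), sub_zero]

theorem fst_eq_zero_of_mem_center (hn : 5 ≤ n) {z : (Fin n → F) × (Fin n → F)}
    (hz : z ∈ (colexAlgebra F n).center) {k : ℕ} (h2 : 2 ≤ k) (hk : k < n) :
    stdForm F n (Y F n k) z = 0 := by
  have h := sum_eq_zero_of_mem_center hn hz (colexPair_lt (k - 2))
  rw [Finset.sum_eq_zero (s := Finset.Ico 2 (n - 1)), add_zero,
    Finset.sum_eq_single_of_mem k (Finset.mem_Ico.2 ⟨h2, hk⟩)] at h
  · simpa using h
  · intro i hi hik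
    refine if_neg fun he => hik ?_
    have := Finset.mem_Ico.1 hi
    have h3 := colexPair_spec (k - 2)
    have h4 := colexPair_spec (i - 2)
    simp only [Prod.mk.eta] at he
    rw [he] at h4
    omega
  · intro i hi
    have := Finset.mem_Ico.1 hi
    rw [snd_eq_zero_of_mem_center hn hz (k := i) (by omega),
      snd_eq_zero_of_mem_center hn hz (k := i + 1) (by omega)]
    simp

theorem center_eq_span (hn : 5 ≤ n) :
    (colexAlgebra F n).center = Submodule.span F (Set.range fun i : Fin 2 => X F n i) := by
  apply le_antisymm
  · intro z hz
    have : z = ∑ i : Fin 2, z.1 ⟨i, by omega⟩ • X F n i := by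
      ext k
      · by_cases hk : (k : ℕ) < 2
        · obtain ⟨k, hkn⟩ := k
          simp only at hk
          interval_cases k <;>
            simp [Fin.sum_univ_two, X, show 0 < n by omega, show 1 < n by omega]
        · have := fst_eq_zero_of_mem_center hn hz (by omega) k.2
          rw [stdForm_Y F n k.2, neg_eq_zero, Fin.eta] at this
          have h0 : k ≠ ⟨0, by omega⟩ := by intro h; simp [h] at hk
          have h1 : k ≠ ⟨1, by omega⟩ := by intro h; simp [h] at hk
          simp [this, Fin.sum_univ_two, X, show 0 < n by omega, show 1 < n by omega, h0, h1]
      · have := snd_eq_zero_of_mem_center hn hz k.2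
        rw [stdForm_X F n k.2, Fin.eta] at this
        simp [this, Fin.sum_univ_two, X, show 0 < n by omega, show 1 < n by omega]
    rw [this]
    exact Submodule.sum_mem _ fun i _ =>
      Submodule.smul_mem _ _ (Submodule.subset_span ⟨i, rfl⟩)
  · rw [Submodule.span_le]
    rintro _ ⟨i, rfl⟩
    rw [SetLike.mem_coe, SAAStruct.center_eq_ucs_one]
    exact X_mem_ucs F n 1 i i.2

theorem finrank_center (hn : 5 ≤ n) : Module.finrank F (colexAlgebra F n).center = 2 := by
  rw [center_eq_span hn, finrank_span_eq_card, Fintype.card_fin]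
  refine Fintype.linearIndependent_iff.2 fun g hg i => ?_
  have h := congrArg (fun u => stdForm F n (Y F n i) u) hg
  simp only [map_sum, map_smul, stdForm_Y_X F n (show (i : ℕ) < n by omega), ← Fin.ext_iff] at h
  simpa using h

end StdSymplectic

theorem three_le_OmegaFn (m : ℕ) : 3 ≤ OmegaFn (m + 2) := by
  induction m with
  | zero => decide
  | succ m ih =>
    have := Nat.choose_le_choose 2 ih
    rw [OmegaFn]
    simp only [show Nat.choose 3 2 = 3 from rfl] at this
    omega

open StdSymplectic in
/-- for a field `F` and `m, n` with `2n ≥ 8` and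
`(Ω(m)+Ω(m+1))/2 < n ≤ Ω(m+1)`, there is a nilpotent SAA of dimension `2n`
over `F` with 2-dimensional center and nilpotency class exactly `2m + 2`. -/
theorem stmt9 (F : Type) [Field F] (m n : ℕ) (h8 : 8 ≤ 2 * n)
    (h1 : OmegaFn m + OmegaFn (m + 1) < 2 * n) (h2 : n ≤ OmegaFn (m + 1)) :
    ∃ B : SAABundle F,
      FiniteDimensional F B.carrier ∧
      B.alg.IsNilpotent ∧
      Module.finrank F B.carrier = 2 * n ∧
      Module.finrank F B.alg.center = 2 ∧
      B.alg.nilClass = 2 * m + 2 := by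
  have hn : 5 ≤ n := by
    rcases m with _ | _ | m
    · simp [OmegaFn] at h2; omega
    · simp [OmegaFn] at h2; omega
    · have h3 := three_le_OmegaFn m
      have h4 := Nat.choose_le_choose 2 h3
      have h5 : OmegaFn (m + 2 + 1) = 2 + (OmegaFn (m + 2)).choose 2 := rfl
      rw [show m + 1 + 1 = m + 2 from rfl] at h1
      simp only [show Nat.choose 3 2 = 3 from rfl] at h4
      omega
  have hdim : Module.finrank F ((Fin n → F) × (Fin n → F)) = 2 * n := by
    rw [Module.finrank_prod, Module.finrank_fin_fun]; omega
  have hchain : (colexAlgebra F n).CentralChain (colexAlgebra F n).ucs (2 * m + 2) := by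
    refine SAAStruct.ucs_centralChain _ ?_
    have := (SAAStruct.lcs_le_ucs_iff _).1 (lcs_le_ucs F n h2)
    rwa [show m + 1 + (m + 1) = 2 * m + 2 by omega] at this
  refine ⟨⟨(Fin n → F) × (Fin n → F), colexAlgebra F n⟩, inferInstance, ⟨_, _, hchain⟩, hdim,
    finrank_center hn, ?_⟩
  refine le_antisymm (Nat.sInf_le ⟨_, hchain⟩) (le_csInf ⟨_, _, hchain⟩ ?_)
  rintro k ⟨I, hI⟩
  exact hI.two_mul_add_two_le (finrank_center hn) (hdim ▸ h1)
end
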